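/- Let A ⊆ ℕ^n be a finite ground set and let C(A) be the SONC cone on A. An extreme ray r of C(A) is not exposed if and only if r = ℝ₊·x^α for some α ∈ A, and there exists a circuit (S, β) on A such that α ∈ S and β ≠ α is an even lattice point. -/

import Mathlib

open MvPolynomial Finset

/-- A lattice exponent is even if every entry is even. -/
def IsEvenPt {n : ℕ} (α : Fin n →₀ ℕ) : Prop := ∀ i, Even (α i)

/-- The embedding of a lattice exponent into `ℝⁿ`. -/
def toR {n : ℕ} (α : Fin n →₀ ℕ) : Fin n → ℝ := fun i => (α i : ℝ)

/-- `(S, β)` is a (simplicial) circuit on the ground set `A`: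
`S ⊆ A ∩ (2ℕ)ⁿ` is affinely independent and `β ∈ A` lies in the relative
interior of `conv S`. -/
structure IsCircuitOn {n : ℕ} (A : Finset (Fin n →₀ ℕ)) (S : Finset (Fin n →₀ ℕ))
    (β : Fin n →₀ ℕ) : Prop where
  subset : S ⊆ A
  even_mem : ∀ α ∈ S, IsEvenPt α
  beta_mem : β ∈ A
  indep : AffineIndependent ℝ (fun α : S => toR (α : Fin n →₀ ℕ))
  relint : toR β ∈ intrinsicInterior ℝ (convexHull ℝ (toR '' (S : Set (Fin n →₀ ℕ))))

/-- `lam` gives the barycentric coordinates of `β` with respect to `S`. -/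
def IsBarycentric {n : ℕ} (S : Finset (Fin n →₀ ℕ)) (β : Fin n →₀ ℕ)
    (lam : (Fin n →₀ ℕ) → ℝ) : Prop :=
  (∀ α ∈ S, 0 < lam α) ∧ ∑ α ∈ S, lam α = 1 ∧
    ∀ i, (β i : ℝ) = ∑ α ∈ S, lam α * (α i : ℝ)

/-- The circuit number `Θ = ∏_{α ∈ S} (c_α / λ_α) ^ (λ_α)`. -/
noncomputable def circuitNumber {n : ℕ} (S : Finset (Fin n →₀ ℕ))
    (c lam : (Fin n →₀ ℕ) → ℝ) : ℝ :=
  ∏ α ∈ S, (c α / lam α) ^ (lam α)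

/-- The circuit polynomial `∑_{α ∈ S} c_α x^α + d x^β`. -/
noncomputable def circuitPoly {n : ℕ} (S : Finset (Fin n →₀ ℕ)) (β : Fin n →₀ ℕ)
    (c : (Fin n →₀ ℕ) → ℝ) (d : ℝ) : MvPolynomial (Fin n) ℝ :=
  (∑ α ∈ S, monomial α (c α)) + monomial β d

/-- Generators of the SONC cone on `A`: nonnegative circuit polynomials on circuits
on `A`, together with monomial squares `x^α`, `α ∈ A ∩ (2ℕ)ⁿ`. -/
def SONCGen {n : ℕ} (A : Finset (Fin n →₀ ℕ)) : Set (MvPolynomial (Fin n) ℝ) :=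
  {f | (∃ S β c d, IsCircuitOn A S β ∧ (∀ α ∈ S, 0 < c α) ∧
          f = circuitPoly S β c d ∧ ∀ x : Fin n → ℝ, 0 ≤ eval x f) ∨
       (∃ α ∈ A, IsEvenPt α ∧ f = monomial α 1)}

/-- The SONC cone on `A`: all finite nonnegative combinations of the generators. -/
def SONCCone {n : ℕ} (A : Finset (Fin n →₀ ℕ)) : Set (MvPolynomial (Fin n) ℝ) :=
  {f | ∃ (k : ℕ) (g : Fin k → MvPolynomial (Fin n) ℝ) (μ : Fin k → ℝ),
        (∀ i, g i ∈ SONCGen A ∧ 0 ≤ μ i) ∧ f = ∑ i, μ i • g i}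

/-- The ray `ℝ₊ · f`. -/
def raySet {n : ℕ} (f : MvPolynomial (Fin n) ℝ) : Set (MvPolynomial (Fin n) ℝ) :=
  {p | ∃ t : ℝ, 0 ≤ t ∧ p = t • f}

/-- `ℝ₊ · f` is an extreme ray of the convex cone `K`. -/
def IsExtremeRay {n : ℕ} (K : Set (MvPolynomial (Fin n) ℝ))
    (f : MvPolynomial (Fin n) ℝ) : Prop :=
  f ≠ 0 ∧ f ∈ K ∧ ∀ g h, g ∈ K → h ∈ K → f = g + h → g ∈ raySet f ∧ h ∈ raySet f

/-- The ray `ℝ₊ · f` is an exposed face of `K`: some linear functional vanishes on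
the ray and is strictly positive on the rest of `K`. -/
def IsExposedRay {n : ℕ} (K : Set (MvPolynomial (Fin n) ℝ))
    (f : MvPolynomial (Fin n) ℝ) : Prop :=
  ∃ l : MvPolynomial (Fin n) ℝ →ₗ[ℝ] ℝ,
    (∀ p ∈ raySet f, l p = 0) ∧ ∀ g ∈ K \ raySet f, 0 < l g

/-- `(S, β)` is a reduced circuit on `A`: the only even points of `A` in `conv S`
are those of `S ∪ {β}`. -/
def IsReducedCircuitOn {n : ℕ} (A : Finset (Fin n →₀ ℕ)) (S : Finset (Fin n →₀ ℕ))
    (β : Fin n →₀ ℕ) : Prop :=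
  IsCircuitOn A S β ∧
    {γ : Fin n →₀ ℕ | γ ∈ A ∧ IsEvenPt γ ∧
        toR γ ∈ convexHull ℝ (toR '' (S : Set (Fin n →₀ ℕ)))} =
      {γ : Fin n →₀ ℕ | (γ ∈ S ∨ γ = β) ∧ IsEvenPt γ}

section AffineIndependence

variable {n : ℕ} {A S : Finset (Fin n →₀ ℕ)} {β : Fin n →₀ ℕ}

/-- Affine independence of a finite set of lattice points, in coordinates. -/
def IsAffIndep (S : Finset (Fin n →₀ ℕ)) : Prop :=
  ∀ w : (Fin n →₀ ℕ) → ℝ, ∑ α ∈ S, w α = 0 → (∀ i, ∑ α ∈ S, w α * (α i : ℝ) = 0) →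
    ∀ α ∈ S, w α = 0

lemma toR_injective : Function.Injective (toR : (Fin n →₀ ℕ) → Fin n → ℝ) := by
  intro a b h
  ext i
  exact Nat.cast_injective (R := ℝ) (congrFun h i)

lemma affineIndependent_toR_iff :
    AffineIndependent ℝ (fun α : S => toR (α : Fin n →₀ ℕ)) ↔ IsAffIndep S := by
  classical
  rw [affineIndependent_iff_of_fintype]
  constructor
  · intro h w h0 h1 α hα
    refine h (fun a => w a) (by rwa [Finset.sum_coe_sort S w]) ?_ ⟨α, hα⟩
    rw [Finset.weightedVSub_eq_linear_combination Finset.univ (by rwa [Finset.sum_coe_sort S w])]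
    ext i
    have := h1 i
    rw [← Finset.sum_coe_sort S] at this
    simpa [Finset.sum_apply, toR] using this
  · intro h w h0 h1 a
    rw [Finset.weightedVSub_eq_linear_combination Finset.univ h0] at h1
    have key := h (fun α => if hα : α ∈ S then w ⟨α, hα⟩ else 0)
      (by rw [← Finset.sum_coe_sort S]; simpa using h0)
      (fun i => by
        rw [← Finset.sum_coe_sort S]
        simpa [Finset.sum_apply, toR] using congrFun h1 i) a a.2
    simpa using key

lemma IsAffIndep.mono {T : Finset (Fin n →₀ ℕ)} (h : IsAffIndep S) (hT : T ⊆ S) :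
    IsAffIndep T := by
  classical
  intro w h0 h1 α hα
  have := h (fun a => if a ∈ T then w a else 0)
    (by rw [Finset.sum_ite_mem, Finset.inter_eq_right.2 hT, h0])
    (fun i => by
      simp only [ite_mul, zero_mul]
      rw [Finset.sum_ite_mem, Finset.inter_eq_right.2 hT, h1 i]) α (hT hα)
  simpa [hα] using this

/-- An affine function on `ℝⁿ` can be prescribed on an affinely independent set. -/
lemma IsAffIndep.exists_interpolation (h : IsAffIndep S) (t : (Fin n →₀ ℕ) → ℝ) :
    ∃ (k : ℝ) (u : Fin n → ℝ), ∀ α ∈ S, k + ∑ i, u i * (α i : ℝ) = t α := by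
  classical
  have hli : LinearIndependent ℝ
      (fun α : S => ((1 : ℝ), toR (α : Fin n →₀ ℕ))) := by
    rw [Fintype.linearIndependent_iff]
    intro g hg a
    have key := h (fun α => if hα : α ∈ S then g ⟨α, hα⟩ else 0)
      (by
        rw [← Finset.sum_coe_sort S]
        simpa [Prod.fst_sum] using congrArg Prod.fst hg)
      (fun i => by
        rw [← Finset.sum_coe_sort S]
        simpa [Prod.snd_sum, Finset.sum_apply, toR] using congrFun (congrArg Prod.snd hg) i) a a.2
    simpa using key
  obtain ⟨g, hg⟩ := LinearMap.exists_extend ((Module.Basis.span hli).constr ℝ (fun a : S => t a))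
  refine ⟨g (1, 0), fun i => g (0, Pi.single i 1), fun α hα => ?_⟩
  have h1 : g ((1 : ℝ), toR α) = t α := by
    have := LinearMap.congr_fun hg (Module.Basis.span hli ⟨α, hα⟩)
    rw [Module.Basis.constr_basis] at this
    simpa [Module.Basis.span_apply] using this
  have h2 : ((1 : ℝ), toR α) = (1, 0) + ∑ i, (α i : ℝ) • ((0 : ℝ), (Pi.single i 1 : Fin n → ℝ)) := by
    ext j
    · simp [Prod.fst_sum]
    · simp [Prod.snd_sum, Finset.sum_apply, toR, Pi.single_apply]
  rw [← h1, h2, map_add, map_sum]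
  simp only [map_smul, smul_eq_mul, mul_comm]

lemma mem_convexHull_toR_iff {x : Fin n → ℝ} :
    x ∈ convexHull ℝ (toR '' (S : Set (Fin n →₀ ℕ))) ↔
      ∃ w : (Fin n →₀ ℕ) → ℝ, (∀ α ∈ S, 0 ≤ w α) ∧ ∑ α ∈ S, w α = 1 ∧
        ∀ i, x i = ∑ α ∈ S, w α * (α i : ℝ) := by
  classical
  constructor
  · intro hx
    rw [← Finset.coe_image, Finset.mem_convexHull'] at hx
    obtain ⟨w, h0, h1, h2⟩ := hx
    rw [Finset.sum_image toR_injective.injOn] at h1 h2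
    refine ⟨fun α => w (toR α), fun α hα => h0 _ (Finset.mem_image_of_mem _ hα), h1, fun i => ?_⟩
    rw [← h2]
    simp [Finset.sum_apply, toR]
  · rintro ⟨w, h0, h1, h2⟩
    have : x = ∑ α ∈ S, w α • toR α := by
      ext i
      rw [h2 i]
      simp [Finset.sum_apply, toR]
    rw [this]
    exact (convex_convexHull ℝ _).sum_mem h0 h1
      fun α hα => subset_convexHull ℝ _ ⟨α, hα, rfl⟩

lemma sum_mul_affine_eq {w : (Fin n →₀ ℕ) → ℝ} {y : Fin n → ℝ} (h1 : ∑ α ∈ S, w α = 1)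
    (h2 : ∀ i, y i = ∑ α ∈ S, w α * (α i : ℝ)) (k : ℝ) (u : Fin n → ℝ) :
    ∑ α ∈ S, w α * (k + ∑ i, u i * (α i : ℝ)) = k + ∑ i, u i * y i := by
  simp only [mul_add, Finset.sum_add_distrib, ← Finset.sum_mul, h1, one_mul, h2, Finset.mul_sum]
  rw [Finset.sum_comm]
  congr 1
  exact Finset.sum_congr rfl fun i _ => Finset.sum_congr rfl fun α _ => by ring

lemma exists_isBarycentric_of_relint (hS : IsAffIndep S)
    (h : toR β ∈ intrinsicInterior ℝ (convexHull ℝ (toR '' (S : Set (Fin n →₀ ℕ))))) :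
    ∃ lam, IsBarycentric S β lam := by
  classical
  obtain ⟨w, h0, h1, h2⟩ := mem_convexHull_toR_iff.1 (intrinsicInterior_subset h)
  refine ⟨w, fun α₀ hα₀ => ?_, h1, h2⟩
  refine lt_of_le_of_ne (h0 _ hα₀) fun hw => ?_
  obtain ⟨k, u, hku⟩ := hS.exists_interpolation (fun α => if α = α₀ then 1 else 0)
  set C := convexHull ℝ (toR '' (S : Set (Fin n →₀ ℕ))) with hC
  set L : (Fin n → ℝ) → ℝ := fun y => k + ∑ i, u i * y i with hL
  have hLC : ∀ y ∈ C, 0 ≤ L y := by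
    intro y hy
    obtain ⟨v, hv0, hv1, hv2⟩ := mem_convexHull_toR_iff.1 hy
    simp only [hL]
    rw [← sum_mul_affine_eq hv1 hv2]
    refine Finset.sum_nonneg fun α hα => mul_nonneg (hv0 α hα) ?_
    rw [hku α hα]
    split_ifs <;> norm_num
  have hLβ : L (toR β) = 0 := by
    simp only [hL]
    rw [← sum_mul_affine_eq h1 h2]
    refine Finset.sum_eq_zero fun α hα => ?_
    rw [hku α hα]
    split_ifs with hc
    · rw [hc, ← hw, zero_mul]
    · simp
  have hLα : L (toR α₀) = 1 := by simpa [hL, toR] using hku α₀ hα₀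
  rw [mem_intrinsicInterior] at h
  obtain ⟨y, hy, hyβ⟩ := h
  have hα₀C : toR α₀ ∈ affineSpan ℝ C := subset_affineSpan ℝ _ (subset_convexHull ℝ _ ⟨α₀, hα₀, rfl⟩)
  set γ : ℝ → affineSpan ℝ C := fun ε =>
    ⟨AffineMap.lineMap (toR β) (toR α₀) ε, AffineMap.lineMap_mem ε (hyβ ▸ y.2) hα₀C⟩ with hγ
  have hγc : Continuous γ := by
    refine Continuous.subtype_mk ?_ _
    exact AffineMap.lineMap_continuous
  have hγ0 : γ 0 = y := by
    ext1
    simp [hγ, hyβ]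
  have hev : ∀ᶠ ε in nhds (0 : ℝ), γ ε ∈ ((↑) ⁻¹' C : Set (affineSpan ℝ C)) := by
    refine hγc.continuousAt.eventually_mem ?_
    rw [hγ0]
    exact mem_interior_iff_mem_nhds.1 hy
  obtain ⟨r, hr, hball⟩ := Metric.eventually_nhds_iff.1 hev
  have hmem := hball (y := -(r / 2)) (by
    rw [Real.dist_eq, sub_zero, abs_neg, abs_of_pos (by positivity)]
    linarith)
  have hneg := hLC _ hmem
  have hval : L (γ (-(r / 2)) : Fin n → ℝ) = -(r / 2) := by
    have hLl : L (γ (-(r / 2)) : Fin n → ℝ) =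
        (1 + r / 2) * L (toR β) + (-(r / 2)) * L (toR α₀) := by
      simp only [hL, hγ, AffineMap.lineMap_apply, vsub_eq_sub, vadd_eq_add, Pi.add_apply,
        Pi.smul_apply, Pi.sub_apply, smul_eq_mul, mul_add, Finset.mul_sum]
      rw [show ∀ a b : ℝ, (1 + r / 2) * k + a + (-(r / 2) * k + b) = k + (a + b) by
        intros; ring, ← Finset.sum_add_distrib]
      congr 1
      exact Finset.sum_congr rfl fun i _ => by ring
    rw [hLl, hLβ, hLα]
    ring
  linarith

lemma IsBarycentric.mem_relint (hS : IsAffIndep S) {lam : (Fin n →₀ ℕ) → ℝ}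
    (h : IsBarycentric S β lam) :
    toR β ∈ intrinsicInterior ℝ (convexHull ℝ (toR '' (S : Set (Fin n →₀ ℕ)))) := by
  classical
  have hcoord : ∀ α₀ : Fin n →₀ ℕ, ∃ (k : ℝ) (u : Fin n → ℝ), ∀ α ∈ S,
      k + ∑ i, u i * (α i : ℝ) = if α = α₀ then 1 else 0 := fun α₀ =>
    hS.exists_interpolation (fun α => if α = α₀ then 1 else 0)
  choose k u hku using hcoord
  set C := convexHull ℝ (toR '' (S : Set (Fin n →₀ ℕ))) with hC
  have hβC : toR β ∈ C := mem_convexHull_toR_iff.2 ⟨lam, fun α hα => (h.1 α hα).le, h.2.1, h.2.2⟩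
  rw [mem_intrinsicInterior]
  refine ⟨⟨toR β, subset_affineSpan ℝ _ hβC⟩, ?_, rfl⟩
  rw [mem_interior]
  refine ⟨{y | ∀ α ∈ S, 0 < k α + ∑ i, u α i * (y : Fin n → ℝ) i}, ?_, ?_, ?_⟩
  · rintro ⟨y, hy⟩ hpos
    rw [hC, affineSpan_convexHull] at hy
    obtain ⟨w, hw1, hw2⟩ : ∃ w : (Fin n →₀ ℕ) → ℝ, ∑ α ∈ S, w α = 1 ∧
        ∀ i, y i = ∑ α ∈ S, w α * (α i : ℝ) := by
      have himg : toR '' (S : Set (Fin n →₀ ℕ)) =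
          Set.range (fun α : S => toR (α : Fin n →₀ ℕ)) := by
        ext z
        simp
      rw [himg] at hy
      obtain ⟨w, hw1, hw2⟩ := eq_affineCombination_of_mem_affineSpan_of_fintype hy
      rw [Finset.affineCombination_eq_linear_combination _ _ _ hw1] at hw2
      refine ⟨fun α => if hα : α ∈ S then w ⟨α, hα⟩ else 0, ?_, fun i => ?_⟩
      · rw [← Finset.sum_coe_sort S]
        simpa using hw1
      · rw [← Finset.sum_coe_sort S, hw2]
        simp [Finset.sum_apply, toR]
    refine mem_convexHull_toR_iff.2 ⟨w, fun α₀ hα₀ => ?_, hw1, hw2⟩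
    have hval : k α₀ + ∑ i, u α₀ i * y i = w α₀ := by
      rw [← sum_mul_affine_eq hw1 hw2, Finset.sum_congr rfl fun α hα => by rw [hku α₀ α hα]]
      simp [hα₀]
    rw [← hval]
    exact (hpos α₀ hα₀).le
  · have : {y : affineSpan ℝ C | ∀ α ∈ S, 0 < k α + ∑ i, u α i * (y : Fin n → ℝ) i} =
        ⋂ α ∈ S, {y : affineSpan ℝ C | 0 < k α + ∑ i, u α i * (y : Fin n → ℝ) i} := by
      ext
      simp
    rw [this]
    exact isOpen_biInter_finset fun α _ => isOpen_lt continuous_const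
      (continuous_const.add (continuous_finsetSum _ fun i _ => continuous_const.mul
        ((continuous_apply i).comp continuous_subtype_val)))
  · intro α₀ hα₀
    have := sum_mul_affine_eq h.2.1 h.2.2 (k α₀) (u α₀)
    rw [Finset.sum_congr rfl fun α hα => by rw [hku α₀ α hα]] at this
    have h2 : lam α₀ = k α₀ + ∑ i, u α₀ i * toR β i := by
      simpa [hα₀, toR] using this
    rw [← h2]
    exact h.1 α₀ hα₀

lemma isCircuitOn_iff :
    IsCircuitOn A S β ↔ S ⊆ A ∧ (∀ α ∈ S, IsEvenPt α) ∧ β ∈ A ∧ IsAffIndep S ∧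
      ∃ lam, IsBarycentric S β lam := by
  constructor
  · intro h
    have hS := affineIndependent_toR_iff.1 h.indep
    exact ⟨h.subset, h.even_mem, h.beta_mem, hS, exists_isBarycentric_of_relint hS h.relint⟩
  · rintro ⟨h1, h2, h3, h4, lam, h5⟩
    exact ⟨h1, h2, h3, affineIndependent_toR_iff.2 h4, h5.mem_relint h4⟩

lemma IsCircuitOn.isAffIndep (h : IsCircuitOn A S β) : IsAffIndep S :=
  affineIndependent_toR_iff.1 h.indep

lemma IsCircuitOn.exists_isBarycentric (h : IsCircuitOn A S β) : ∃ lam, IsBarycentric S β lam :=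
  exists_isBarycentric_of_relint h.isAffIndep h.relint

end AffineIndependence

section Barycentric

variable {n : ℕ} {A S : Finset (Fin n →₀ ℕ)} {β : Fin n →₀ ℕ} {lam : (Fin n →₀ ℕ) → ℝ}

lemma IsAffIndep.isBarycentric_unique (hS : IsAffIndep S) {lam' : (Fin n →₀ ℕ) → ℝ}
    (h : IsBarycentric S β lam) (h' : IsBarycentric S β lam') : ∀ α ∈ S, lam' α = lam α := by
  intro α hα
  have := hS (fun a => lam' a - lam a) (by rw [Finset.sum_sub_distrib, h.2.1, h'.2.1, sub_self])
    (fun i => by simp only [sub_mul, Finset.sum_sub_distrib, ← h.2.2, ← h'.2.2, sub_self]) α hα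
  linarith

/-- Two barycentric representations of a point by an affinely independent set and
one of its subsets use the same vertices. -/
lemma IsAffIndep.eq_of_subset_of_isBarycentric (hS : IsAffIndep S) {T : Finset (Fin n →₀ ℕ)}
    {lam' : (Fin n →₀ ℕ) → ℝ} (h : IsBarycentric S β lam) (hT : T ⊆ S)
    (h' : IsBarycentric T β lam') : T = S := by
  classical
  refine Finset.Subset.antisymm hT fun α hα => ?_
  by_contra hαT
  have hTS : S ∩ T = T := Finset.inter_eq_right.2 hT
  have := hS (fun a => lam a - if a ∈ T then lam' a else 0)
    (by rw [Finset.sum_sub_distrib, Finset.sum_ite_mem, hTS, h.2.1, h'.2.1, sub_self])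
    (fun i => by
      simp only [sub_mul, Finset.sum_sub_distrib, ← h.2.2, ite_mul, zero_mul]
      rw [Finset.sum_ite_mem, hTS, ← h'.2.2, sub_self]) α hα
  simp only [hαT, if_false, sub_zero] at this
  exact (h.1 α hα).ne' this

lemma isBarycentric_singleton : IsBarycentric {β} β (fun _ => 1) := by
  simp [IsBarycentric]

lemma IsAffIndep.eq_singleton_of_mem (hS : IsAffIndep S) (h : IsBarycentric S β lam)
    (hβ : β ∈ S) : S = {β} :=
  (hS.eq_of_subset_of_isBarycentric h (Finset.singleton_subset_iff.2 hβ)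
    isBarycentric_singleton).symm

lemma IsBarycentric.exists_ne (h : IsBarycentric S β lam) (hβ : β ∉ S) (γ : Fin n →₀ ℕ) :
    ∃ α ∈ S, α ≠ γ := by
  by_contra! hc
  have hne : S.Nonempty := by
    rw [Finset.nonempty_iff_ne_empty]
    rintro rfl
    simpa using h.2.1
  obtain rfl : S = {γ} := Finset.eq_singleton_iff_nonempty_unique_mem.2 ⟨hne, hc⟩
  apply hβ
  have h1 : lam γ = 1 := by simpa using h.2.1
  have : β = γ := by
    ext i
    have := h.2.2 i
    rw [Finset.sum_singleton, h1, one_mul] at this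
    exact_mod_cast this
  simp [this]

lemma IsBarycentric.sq_lt (h : IsBarycentric S β lam) (hβ : β ∉ S) :
    ∑ i, (β i : ℝ) ^ 2 < ∑ α ∈ S, lam α * ∑ i, (α i : ℝ) ^ 2 := by
  have key : 0 < ∑ α ∈ S, lam α * ∑ i, ((α i : ℝ) - β i) ^ 2 := by
    obtain ⟨α, hα, hαβ⟩ := h.exists_ne hβ β
    refine Finset.sum_pos' (fun a ha => mul_nonneg (h.1 a ha).le
      (Finset.sum_nonneg fun i _ => sq_nonneg _)) ⟨α, hα, mul_pos (h.1 α hα) ?_⟩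
    obtain ⟨i, hi⟩ : ∃ i, α i ≠ β i := by
      by_contra! hc
      exact hαβ (Finsupp.ext hc)
    refine Finset.sum_pos' (fun j _ => sq_nonneg _) ⟨i, Finset.mem_univ _, ?_⟩
    have : (α i : ℝ) - β i ≠ 0 := sub_ne_zero.2 (by exact_mod_cast hi)
    positivity
  have e : ∑ α ∈ S, lam α * ∑ i, ((α i : ℝ) - β i) ^ 2 =
      ∑ α ∈ S, lam α * (∑ i, (α i : ℝ) ^ 2) - ∑ i, (β i : ℝ) ^ 2 := by
    have e1 : ∀ α : Fin n →₀ ℕ, ∑ i, ((α i : ℝ) - β i) ^ 2 =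
        ∑ i, (α i : ℝ) ^ 2 +
          (∑ i, (β i : ℝ) ^ 2 + ∑ i, (-2 * (β i : ℝ)) * (α i : ℝ)) := fun α => by
      rw [← Finset.sum_add_distrib, ← Finset.sum_add_distrib]
      exact Finset.sum_congr rfl fun i _ => by ring
    rw [Finset.sum_congr rfl fun α _ => by rw [e1 α, mul_add], Finset.sum_add_distrib]
    have := sum_mul_affine_eq h.2.1 h.2.2 (∑ i, (β i : ℝ) ^ 2) (fun i => -2 * (β i : ℝ))
    rw [this]
    have e2 : ∑ i, (-2 * (β i : ℝ)) * (β i : ℝ) = -2 * ∑ i, (β i : ℝ) ^ 2 := by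
      rw [Finset.mul_sum]
      exact Finset.sum_congr rfl fun i _ => by ring
    rw [e2]
    ring
  linarith

/-- Jensen's inequality for `exp`. -/
lemma exp_sum_mul_exp_le {w b : (Fin n →₀ ℕ) → ℝ} (h : IsBarycentric S β lam) :
    Real.exp (∑ α ∈ S, lam α * b α) * Real.exp (∑ α ∈ S, lam α * w α) ≤
      ∑ α ∈ S, lam α * Real.exp (b α) * Real.exp (w α) := by
  have := convexOn_exp.map_sum_le (t := S) (w := lam) (p := fun α => b α + w α)
    (fun α hα => (h.1 α hα).le) h.2.1 (fun _ _ => Set.mem_univ _)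
  simpa [mul_add, Finset.sum_add_distrib, Real.exp_add, mul_assoc] using this

lemma exp_sum_mul_exp_lt {w b : (Fin n →₀ ℕ) → ℝ} {t : ℝ} (h : IsBarycentric S β lam)
    (ht : t < ∑ α ∈ S, lam α * w α) :
    Real.exp (∑ α ∈ S, lam α * b α) * Real.exp t <
      ∑ α ∈ S, lam α * Real.exp (b α) * Real.exp (w α) :=
  lt_of_lt_of_le (by gcongr) (exp_sum_mul_exp_le h)

lemma eq_of_exp_sum_mul_exp_eq {w b : (Fin n →₀ ℕ) → ℝ} (h : IsBarycentric S β lam)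
    (heq : ∑ α ∈ S, lam α * Real.exp (b α) * Real.exp (w α) ≤
      Real.exp (∑ α ∈ S, lam α * b α) * Real.exp (∑ α ∈ S, lam α * w α)) :
    ∃ τ, ∀ α ∈ S, b α + w α = τ := by
  have := strictConvexOn_exp.eq_of_le_map_sum (t := S) (w := lam) (p := fun α => b α + w α)
    h.1 h.2.1 (fun _ _ => Set.mem_univ _)
    (by simpa [mul_add, Finset.sum_add_distrib, Real.exp_add, mul_assoc] using heq)
  obtain rfl | ⟨α₀, hα₀⟩ := S.eq_empty_or_nonempty
  · simp
  · exact ⟨_, fun α hα => this hα hα₀⟩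

end Barycentric

section CircuitPoly

variable {n : ℕ} {A S : Finset (Fin n →₀ ℕ)} {β : Fin n →₀ ℕ} {lam b : (Fin n →₀ ℕ) → ℝ}

lemma circuitPoly_congr {c c' : (Fin n →₀ ℕ) → ℝ} {d : ℝ} (h : ∀ α ∈ S, c α = c' α) :
    circuitPoly S β c d = circuitPoly S β c' d := by
  unfold circuitPoly
  rw [Finset.sum_congr rfl fun α hα => by rw [h α hα]]

lemma eval_circuitPoly (c : (Fin n →₀ ℕ) → ℝ) (d : ℝ) (x : Fin n → ℝ) :
    eval x (circuitPoly S β c d) =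
      ∑ α ∈ S, c α * ∏ i, x i ^ α i + d * ∏ i, x i ^ β i := by
  simp [circuitPoly, eval_monomial, Finsupp.prod_fintype]

lemma IsEvenPt.prod_abs {α : Fin n →₀ ℕ} (h : IsEvenPt α) (x : Fin n → ℝ) :
    ∏ i, |x i| ^ α i = ∏ i, x i ^ α i :=
  Finset.prod_congr rfl fun i _ => (h i).pow_abs _

/-- The weighted AM-GM inequality for circuits. -/
lemma IsBarycentric.exp_mul_abs_le (h : IsBarycentric S β lam) (hS : ∀ α ∈ S, IsEvenPt α)
    (x : Fin n → ℝ) :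
    Real.exp (∑ α ∈ S, lam α * b α) * |∏ i, x i ^ β i| ≤
      ∑ α ∈ S, lam α * Real.exp (b α) * ∏ i, x i ^ α i := by
  have hpos : ∀ α : Fin n →₀ ℕ, 0 ≤ ∏ i, |x i| ^ α i := fun α =>
    Finset.prod_nonneg fun i _ => pow_nonneg (abs_nonneg _) _
  have key := Real.geom_mean_le_arith_mean_weighted S lam
    (fun α => Real.exp (b α) * ∏ i, |x i| ^ α i) (fun α hα => (h.1 α hα).le) h.2.1
    (fun α _ => mul_nonneg (Real.exp_pos _).le (hpos α))
  have e1 : ∏ α ∈ S, (Real.exp (b α) * ∏ i, |x i| ^ α i) ^ lam α =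
      Real.exp (∑ α ∈ S, lam α * b α) * |∏ i, x i ^ β i| := by
    rw [Finset.prod_congr rfl fun α _ => Real.mul_rpow (Real.exp_pos (b α)).le (hpos α),
      Finset.prod_mul_distrib]
    congr 1
    · rw [Real.exp_sum]
      exact Finset.prod_congr rfl fun α _ => by rw [← Real.exp_mul, mul_comm]
    · rw [Finset.abs_prod, Finset.prod_congr rfl fun α _ => (Real.finsetProd_rpow _ _
        (fun i _ => pow_nonneg (abs_nonneg (x i)) (α i)) (lam α)).symm, Finset.prod_comm]
      refine Finset.prod_congr rfl fun i _ => ?_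
      rw [abs_pow, ← Real.rpow_natCast |x i| (β i), h.2.2 i,
        Real.rpow_sum_of_nonneg (abs_nonneg _)
          fun α hα => mul_nonneg (h.1 α hα).le (Nat.cast_nonneg _)]
      exact Finset.prod_congr rfl fun α _ => by
        rw [mul_comm, Real.rpow_mul (abs_nonneg _), Real.rpow_natCast]
  rw [e1] at key
  refine key.trans_eq (Finset.sum_congr rfl fun α hα => ?_)
  rw [(hS α hα).prod_abs, mul_assoc]

lemma IsBarycentric.eval_circuitPoly_nonneg (h : IsBarycentric S β lam)
    (hS : ∀ α ∈ S, IsEvenPt α) {d : ℝ} (hd : -Real.exp (∑ α ∈ S, lam α * b α) ≤ d)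
    (hd' : ¬ IsEvenPt β → d ≤ Real.exp (∑ α ∈ S, lam α * b α)) (x : Fin n → ℝ) :
    0 ≤ eval x (circuitPoly S β (fun α => lam α * Real.exp (b α)) d) := by
  rw [eval_circuitPoly]
  have key := h.exp_mul_abs_le (b := b) hS x
  set Θ := Real.exp (∑ α ∈ S, lam α * b α)
  suffices -(Θ * |∏ i, x i ^ β i|) ≤ d * ∏ i, x i ^ β i by linarith
  by_cases hβ : IsEvenPt β
  · have hp : 0 ≤ ∏ i, x i ^ β i := Finset.prod_nonneg fun i _ => (hβ i).pow_nonneg _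
    rw [abs_of_nonneg hp]
    nlinarith
  · have hdΘ : |d| ≤ Θ := abs_le.2 ⟨hd, hd' hβ⟩
    have := neg_abs_le (d * ∏ i, x i ^ β i)
    rw [abs_mul] at this
    have := mul_le_mul_of_nonneg_right hdΘ (abs_nonneg (∏ i, x i ^ β i))
    linarith

/-- A nonnegative circuit polynomial satisfies the circuit number bounds. -/
lemma IsBarycentric.bounds_of_eval_nonneg (h : IsBarycentric S β lam) (hSi : IsAffIndep S)
    (hS : ∀ α ∈ S, IsEvenPt α) {d : ℝ}
    (hpos : ∀ x : Fin n → ℝ,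
      0 ≤ eval x (circuitPoly S β (fun α => lam α * Real.exp (b α)) d)) :
    -Real.exp (∑ α ∈ S, lam α * b α) ≤ d ∧
      (¬ IsEvenPt β → d ≤ Real.exp (∑ α ∈ S, lam α * b α)) := by
  obtain ⟨k, u, hku⟩ := hSi.exists_interpolation (fun α => -b α)
  have hprod : ∀ α : Fin n →₀ ℕ, ∏ i, Real.exp (u i) ^ α i =
      Real.exp (∑ i, u i * (α i : ℝ)) := fun α => by
    rw [Real.exp_sum]
    exact Finset.prod_congr rfl fun i _ => by rw [← Real.exp_nat_mul, mul_comm]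
  have hsum : ∑ α ∈ S, lam α * Real.exp (b α) * ∏ i, Real.exp (u i) ^ α i = Real.exp (-k) := by
    have : ∀ α ∈ S, lam α * Real.exp (b α) * ∏ i, Real.exp (u i) ^ α i =
        lam α * Real.exp (-k) := fun α hα => by
      rw [hprod, mul_assoc, ← Real.exp_add]
      congr 2
      linarith [hku α hα]
    rw [Finset.sum_congr rfl this, ← Finset.sum_mul, h.2.1, one_mul]
  have hβp : ∏ i, Real.exp (u i) ^ β i =
      Real.exp (-k) * (Real.exp (∑ α ∈ S, lam α * b α))⁻¹ := by
    have := sum_mul_affine_eq h.2.1 h.2.2 k u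
    rw [Finset.sum_congr rfl fun α hα => by rw [hku α hα]] at this
    rw [hprod, ← Real.exp_neg, ← Real.exp_add]
    congr 1
    simp only [mul_neg, Finset.sum_neg_distrib] at this
    linarith
  have hΘ := Real.exp_pos (∑ α ∈ S, lam α * b α)
  have hk := Real.exp_pos (-k)
  set Θ := Real.exp (∑ α ∈ S, lam α * b α)
  have fin : ∀ e : ℝ, 0 ≤ Real.exp (-k) + e * (Real.exp (-k) * Θ⁻¹) → -Θ ≤ e := by
    intro e he
    have : 0 ≤ Real.exp (-k) * Θ⁻¹ * (Θ + e) := by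
      have e1 : Real.exp (-k) * Θ⁻¹ * (Θ + e) = Real.exp (-k) + e * (Real.exp (-k) * Θ⁻¹) := by
        field_simp
      rwa [e1]
    have := nonneg_of_mul_nonneg_right this (by positivity)
    linarith
  constructor
  · have := hpos (fun i => Real.exp (u i))
    rw [eval_circuitPoly, hsum, hβp] at this
    exact fin d this
  · intro hβ
    obtain ⟨j, hj⟩ : ∃ j, ¬ Even (β j) := by simpa [IsEvenPt] using hβ
    have := hpos (fun i => (if i = j then -1 else 1) * Real.exp (u i))
    have hsgn : ∀ α : Fin n →₀ ℕ, ∏ i, ((if i = j then (-1 : ℝ) else 1) * Real.exp (u i)) ^ α i =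
        (-1) ^ α j * ∏ i, Real.exp (u i) ^ α i := fun α => by
      simp only [mul_pow, Finset.prod_mul_distrib]
      congr 1
      rw [Finset.prod_eq_single j (fun i _ hi => by simp [hi]) (by simp)]
      simp
    rw [eval_circuitPoly, hsgn, (Nat.not_even_iff_odd.1 hj).neg_one_pow, hβp,
      Finset.sum_congr rfl fun α hα => by rw [hsgn, (hS α hα j).neg_one_pow, one_mul],
      hsum] at this
    have := fin (-d) (by linarith)
    linarith

end CircuitPoly

section Cone

variable {n : ℕ} {A S : Finset (Fin n →₀ ℕ)} {β : Fin n →₀ ℕ} {lam b : (Fin n →₀ ℕ) → ℝ}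
  {f g h : MvPolynomial (Fin n) ℝ}

lemma mem_raySet_self (f : MvPolynomial (Fin n) ℝ) : f ∈ raySet f :=
  ⟨1, zero_le_one, (one_smul ℝ f).symm⟩

lemma zero_mem_raySet (f : MvPolynomial (Fin n) ℝ) : 0 ∈ raySet f :=
  ⟨0, le_rfl, (zero_smul ℝ f).symm⟩

lemma smul_mem_raySet {t : ℝ} (ht : 0 ≤ t) (hg : g ∈ raySet f) : t • g ∈ raySet f := by
  obtain ⟨s, hs, rfl⟩ := hg
  exact ⟨t * s, mul_nonneg ht hs, smul_smul _ _ _⟩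

lemma sum_mem_raySet {ι : Type*} {s : Finset ι} {p : ι → MvPolynomial (Fin n) ℝ}
    (hp : ∀ i ∈ s, p i ∈ raySet f) : ∑ i ∈ s, p i ∈ raySet f := by
  refine Finset.sum_induction p (· ∈ raySet f) ?_ (zero_mem_raySet f) hp
  rintro _ _ ⟨s, hs, rfl⟩ ⟨t, ht, rfl⟩
  exact ⟨s + t, add_nonneg hs ht, (add_smul _ _ _).symm⟩

lemma raySet_smul {t : ℝ} (ht : 0 < t) : raySet (t • f) = raySet f := by
  ext p
  constructor
  · rintro ⟨s, hs, rfl⟩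
    exact ⟨s * t, mul_nonneg hs ht.le, smul_smul _ _ _⟩
  · rintro ⟨s, hs, rfl⟩
    refine ⟨s / t, div_nonneg hs ht.le, ?_⟩
    rw [smul_smul, div_mul_cancel₀ _ ht.ne']

lemma SONCGen.mem_cone (hg : g ∈ SONCGen A) : g ∈ SONCCone A :=
  ⟨1, fun _ => g, fun _ => 1, fun _ => ⟨hg, zero_le_one⟩, by simp⟩

lemma SONCCone.zero_mem : (0 : MvPolynomial (Fin n) ℝ) ∈ SONCCone A :=
  ⟨0, fun _ => 0, fun _ => 0, fun i => i.elim0, by simp⟩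

lemma SONCCone.smul_mem {t : ℝ} (ht : 0 ≤ t) (hg : g ∈ SONCCone A) : t • g ∈ SONCCone A := by
  obtain ⟨k, p, μ, hp, rfl⟩ := hg
  refine ⟨k, p, fun i => t * μ i, fun i => ⟨(hp i).1, mul_nonneg ht (hp i).2⟩, ?_⟩
  simp [Finset.smul_sum, smul_smul]

lemma SONCCone.add_mem (hg : g ∈ SONCCone A) (hh : h ∈ SONCCone A) : g + h ∈ SONCCone A := by
  obtain ⟨k, p, μ, hp, rfl⟩ := hg
  obtain ⟨m, q, ν, hq, rfl⟩ := hh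
  refine ⟨k + m, Fin.append p q, Fin.append μ ν, fun i => ?_, ?_⟩
  · induction i using Fin.addCases with
    | left i => simpa using hp i
    | right i => simpa using hq i
  · simp [Fin.sum_univ_add]

lemma SONCCone.sum_mem {ι : Type*} {s : Finset ι} {p : ι → MvPolynomial (Fin n) ℝ}
    (hp : ∀ i ∈ s, p i ∈ SONCCone A) : ∑ i ∈ s, p i ∈ SONCCone A :=
  Finset.sum_induction p (· ∈ SONCCone A) (fun _ _ => SONCCone.add_mem) SONCCone.zero_mem hp

lemma SONCCone.monomial_mem {α : Fin n →₀ ℕ} (hα : α ∈ A) (he : IsEvenPt α) {t : ℝ}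
    (ht : 0 ≤ t) : monomial α t ∈ SONCCone A := by
  have := SONCCone.smul_mem ht (SONCGen.mem_cone (Or.inr ⟨α, hα, he, rfl⟩))
  simpa [smul_monomial] using this

lemma IsCircuitOn.circuitPoly_mem_cone (hc : IsCircuitOn A S β) (hlam : IsBarycentric S β lam)
    {d : ℝ} (hd : -Real.exp (∑ α ∈ S, lam α * b α) ≤ d)
    (hd' : ¬ IsEvenPt β → d ≤ Real.exp (∑ α ∈ S, lam α * b α)) :
    circuitPoly S β (fun α => lam α * Real.exp (b α)) d ∈ SONCCone A :=
  SONCGen.mem_cone (Or.inl ⟨S, β, _, d, hc,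
    fun α hα => mul_pos (hlam.1 α hα) (Real.exp_pos _), rfl,
    hlam.eval_circuitPoly_nonneg hc.even_mem hd hd'⟩)

/-- Every generator is a monomial square or a nondegenerate circuit polynomial whose inner
coefficient obeys the circuit number bounds. -/
lemma SONCGen.cases (hg : g ∈ SONCGen A) :
    (∃ α ∈ A, IsEvenPt α ∧ ∃ t : ℝ, 0 ≤ t ∧ g = monomial α t) ∨
    ∃ (S : Finset (Fin n →₀ ℕ)) (β : Fin n →₀ ℕ) (lam b : (Fin n →₀ ℕ) → ℝ) (d : ℝ),
      IsCircuitOn A S β ∧ β ∉ S ∧ IsBarycentric S β lam ∧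
      g = circuitPoly S β (fun α => lam α * Real.exp (b α)) d ∧
      -Real.exp (∑ α ∈ S, lam α * b α) ≤ d ∧
      (¬ IsEvenPt β → d ≤ Real.exp (∑ α ∈ S, lam α * b α)) := by
  obtain ⟨S, β, c, d, hc, hcpos, rfl, hpos⟩ | ⟨α, hα, he, rfl⟩ := hg
  · obtain ⟨lam, hlam⟩ := hc.exists_isBarycentric
    by_cases hβ : β ∈ S
    · refine Or.inl ⟨β, hc.beta_mem, hc.even_mem β hβ, c β + d, ?_, ?_⟩
      · have := hpos 1
        rw [hc.isAffIndep.eq_singleton_of_mem hlam hβ, eval_circuitPoly] at this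
        simpa using this
      · rw [hc.isAffIndep.eq_singleton_of_mem hlam hβ]
        simp [circuitPoly]
    · have hcong : circuitPoly S β c d =
          circuitPoly S β (fun α => lam α * Real.exp (Real.log (c α / lam α))) d :=
        circuitPoly_congr fun α hα => by
          rw [Real.exp_log (div_pos (hcpos α hα) (hlam.1 α hα)),
            mul_div_cancel₀ _ (hlam.1 α hα).ne']
      rw [hcong] at hpos ⊢
      have := hlam.bounds_of_eval_nonneg (b := fun α => Real.log (c α / lam α))
        hc.isAffIndep hc.even_mem hpos
      exact Or.inr ⟨S, β, lam, _, d, hc, hβ, hlam, rfl, this.1, this.2⟩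
  · exact Or.inl ⟨α, hα, he, 1, zero_le_one, rfl⟩

/-- The linear functional on polynomials with prescribed values on monomials. -/
noncomputable def coeffFunctional (a : (Fin n →₀ ℕ) → ℝ) : MvPolynomial (Fin n) ℝ →ₗ[ℝ] ℝ :=
  (basisMonomials (Fin n) ℝ).constr ℝ a

lemma coeffFunctional_monomial (a : (Fin n →₀ ℕ) → ℝ) (α : Fin n →₀ ℕ) (c : ℝ) :
    coeffFunctional a (monomial α c) = c * a α := by
  have h1 : coeffFunctional a (monomial α (1 : ℝ)) = a α := by
    have := (basisMonomials (Fin n) ℝ).constr_basis ℝ a α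
    rwa [coe_basisMonomials] at this
  have h2 : (monomial α c : MvPolynomial (Fin n) ℝ) = c • monomial α 1 := by
    simp [smul_monomial]
  rw [h2, map_smul, h1, smul_eq_mul]

lemma map_circuitPoly (l : MvPolynomial (Fin n) ℝ →ₗ[ℝ] ℝ) (c : (Fin n →₀ ℕ) → ℝ) (d : ℝ) :
    l (circuitPoly S β c d) = ∑ α ∈ S, c α * l (monomial α 1) + d * l (monomial β 1) := by
  have h : ∀ (α : Fin n →₀ ℕ) (t : ℝ), l (monomial α t) = t * l (monomial α 1) := fun α t => by
    rw [← smul_eq_mul, ← map_smul, smul_monomial, smul_eq_mul, mul_one]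
  rw [circuitPoly, map_add, map_sum, h β d]
  simp only [← h]

lemma coeffFunctional_circuitPoly (a c : (Fin n →₀ ℕ) → ℝ) (d : ℝ) :
    coeffFunctional a (circuitPoly S β c d) = ∑ α ∈ S, c α * a α + d * a β := by
  simp [map_circuitPoly, coeffFunctional_monomial]

lemma isExposedRay_of_gen (l : MvPolynomial (Fin n) ℝ →ₗ[ℝ] ℝ) (hf : l f = 0)
    (hg : ∀ g ∈ SONCGen A, 0 ≤ l g ∧ (l g = 0 → g ∈ raySet f)) :
    IsExposedRay (SONCCone A) f := by
  refine ⟨l, ?_, ?_⟩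
  · rintro _ ⟨t, -, rfl⟩
    rw [map_smul, hf, smul_zero]
  · rintro _ ⟨⟨k, p, μ, hp, rfl⟩, hnot⟩
    have hnn : ∀ i ∈ Finset.univ, 0 ≤ μ i * l (p i) :=
      fun i _ => mul_nonneg (hp i).2 (hg _ (hp i).1).1
    have hl : l (∑ i, μ i • p i) = ∑ i, μ i * l (p i) := by simp
    rw [hl]
    refine lt_of_le_of_ne (Finset.sum_nonneg hnn) fun h0 => hnot ?_
    refine sum_mem_raySet fun i hi => ?_
    rcases mul_eq_zero.1 ((Finset.sum_eq_zero_iff_of_nonneg hnn).1 h0.symm i hi) with h | h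
    · rw [h, zero_smul]
      exact zero_mem_raySet f
    · exact smul_mem_raySet (hp i).2 ((hg _ (hp i).1).2 h)

lemma IsExtremeRay.smul (hf : IsExtremeRay (SONCCone A) f) {t : ℝ} (ht : 0 < t) :
    IsExtremeRay (SONCCone A) (t • f) := by
  refine ⟨smul_ne_zero ht.ne' hf.1, SONCCone.smul_mem ht.le hf.2.1, fun p q hp hq hpq => ?_⟩
  have hti := inv_pos.2 ht
  rw [raySet_smul ht]
  have := hf.2.2 _ _ (SONCCone.smul_mem hti.le hp) (SONCCone.smul_mem hti.le hq)
    (by rw [← smul_add, ← hpq, smul_smul, inv_mul_cancel₀ ht.ne', one_smul])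
  have back : ∀ p : MvPolynomial (Fin n) ℝ, t⁻¹ • p ∈ raySet f → p ∈ raySet f := fun p hp => by
    have := smul_mem_raySet ht.le hp
    rwa [smul_smul, mul_inv_cancel₀ ht.ne', one_smul] at this
  exact ⟨back _ this.1, back _ this.2⟩

/-- An extreme ray of the SONC cone is spanned by a generator. -/
lemma IsExtremeRay.exists_gen (hf : IsExtremeRay (SONCCone A) f) :
    ∃ g ∈ SONCGen A, raySet f = raySet g ∧ IsExtremeRay (SONCCone A) g := by
  classical
  obtain ⟨k, p, μ, hp, hsum⟩ := hf.2.1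
  have hmem : ∀ i, μ i • p i ∈ SONCCone A := fun i =>
    SONCCone.smul_mem (hp i).2 (SONCGen.mem_cone (hp i).1)
  obtain ⟨i, hi⟩ : ∃ i, μ i • p i ≠ 0 := by
    by_contra! hc
    exact hf.1 (by rw [hsum, Finset.sum_eq_zero fun i _ => hc i])
  obtain ⟨t, ht, hti⟩ := (hf.2.2 _ _ (hmem i)
    (SONCCone.sum_mem (s := Finset.univ.erase i) fun j _ => hmem j)
    (by rw [hsum, Finset.add_sum_erase _ (fun j => μ j • p j) (Finset.mem_univ i)])).1
  have hμ : 0 < μ i := lt_of_le_of_ne (hp i).2 fun h => hi (by rw [← h, zero_smul])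
  have ht' : 0 < t := lt_of_le_of_ne ht fun h => hi (by rw [hti, ← h, zero_smul])
  have hpi : p i = (t / μ i) • f := by
    rw [div_eq_inv_mul, mul_smul, ← hti, smul_smul, inv_mul_cancel₀ hμ.ne', one_smul]
  refine ⟨p i, (hp i).1, ?_, ?_⟩
  · rw [hpi, raySet_smul (div_pos ht' hμ)]
  · rw [hpi]
    exact hf.smul (div_pos ht' hμ)

lemma raySet_monomial (α : Fin n →₀ ℕ) {t : ℝ} (ht : 0 < t) :
    raySet (monomial α t : MvPolynomial (Fin n) ℝ) = raySet (monomial α (1 : ℝ)) := by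
  have : (monomial α t : MvPolynomial (Fin n) ℝ) = t • monomial α 1 := by simp [smul_monomial]
  rw [this, raySet_smul ht]

lemma IsExtremeRay.raySet_eq_monomial (hf : IsExtremeRay (SONCCone A) f) {α : Fin n →₀ ℕ}
    (hα : α ∈ A) (he : IsEvenPt α) {t : ℝ} (ht : 0 < t) (hh : h ∈ SONCCone A)
    (heq : f = monomial α t + h) : raySet f = raySet (monomial α (1 : ℝ)) := by
  obtain ⟨s, hs, hst⟩ := (hf.2.2 _ _ (SONCCone.monomial_mem hα he ht.le) hh heq).1
  have hs' : 0 < s := lt_of_le_of_ne hs fun h0 => by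
    rw [← h0, zero_smul, monomial_eq_zero] at hst
    exact ht.ne' hst
  rw [← raySet_monomial α ht, hst, raySet_smul hs']

/-- An extreme circuit polynomial which is not a monomial has extremal inner coefficient. -/
lemma IsExtremeRay.eq_circuitNumber
    {d : ℝ} (hf : IsExtremeRay (SONCCone A)
      (circuitPoly S β (fun α => lam α * Real.exp (b α)) d))
    (hc : IsCircuitOn A S β) (hβ : β ∉ S) (hlam : IsBarycentric S β lam)
    (hd : -Real.exp (∑ α ∈ S, lam α * b α) ≤ d)
    (hd' : ¬ IsEvenPt β → d ≤ Real.exp (∑ α ∈ S, lam α * b α)) :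
    (∃ α ∈ S, raySet (circuitPoly S β (fun α => lam α * Real.exp (b α)) d) =
      raySet (monomial α (1 : ℝ))) ∨
    d = -Real.exp (∑ α ∈ S, lam α * b α) ∨
      (¬ IsEvenPt β ∧ d = Real.exp (∑ α ∈ S, lam α * b α)) := by
  classical
  by_contra! hcon
  obtain ⟨hmon, hne, hne'⟩ := hcon
  obtain ⟨α₀, hα₀, -⟩ := hlam.exists_ne hβ β
  apply hmon α₀ hα₀
  have hΘ := Real.exp_pos (∑ α ∈ S, lam α * b α)
  set Θ := Real.exp (∑ α ∈ S, lam α * b α) with hΘdef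
  have hlt : -d / Θ < 1 := by
    rw [div_lt_one hΘ]
    have := lt_of_le_of_ne hd (Ne.symm hne)
    linarith
  obtain ⟨r, hr, hr1⟩ : ∃ r : ℝ, (0 < r ∧ -d ≤ r * Θ ∧ (¬ IsEvenPt β → d ≤ r * Θ)) ∧ r < 1 := by
    by_cases hev : IsEvenPt β
    · obtain ⟨r, h1, h2⟩ := exists_between (max_lt zero_lt_one hlt)
      rw [max_lt_iff, div_lt_iff₀ hΘ] at h1
      exact ⟨r, ⟨h1.1, h1.2.le, fun h => absurd hev h⟩, h2⟩
    · have hlt' : d / Θ < 1 := by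
        rw [div_lt_one hΘ]
        exact lt_of_le_of_ne (hd' hev) (hne' hev)
      obtain ⟨r, h1, h2⟩ := exists_between (max_lt (max_lt zero_lt_one hlt) hlt')
      rw [max_lt_iff, max_lt_iff, div_lt_iff₀ hΘ, div_lt_iff₀ hΘ] at h1
      exact ⟨r, ⟨h1.1.1, h1.1.2.le, fun _ => h1.2.le⟩, h2⟩
  obtain ⟨hr0, hrd, hrd'⟩ := hr
  have hexp : Real.exp (∑ α ∈ S, lam α * (b α + Real.log r)) = r * Θ := by
    simp only [mul_add, Finset.sum_add_distrib, ← Finset.sum_mul, hlam.2.1, one_mul]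
    rw [Real.exp_add, Real.exp_log hr0, mul_comm]
  have hmem := hc.circuitPoly_mem_cone (b := fun α => b α + Real.log r) hlam (d := d)
    (by rw [hexp]; linarith) (by rwa [hexp])
  have hrest : ∑ α ∈ S.erase α₀, monomial α ((1 - r) * (lam α * Real.exp (b α))) ∈ SONCCone A :=
    SONCCone.sum_mem fun α hα => by
      have hαS := Finset.mem_of_mem_erase hα
      exact SONCCone.monomial_mem (hc.subset hαS) (hc.even_mem α hαS)
        (mul_nonneg (by linarith) (mul_nonneg (hlam.1 α hαS).le (Real.exp_pos _).le))
  refine hf.raySet_eq_monomial (hc.subset hα₀) (hc.even_mem α₀ hα₀)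
    (t := (1 - r) * (lam α₀ * Real.exp (b α₀)))
    (mul_pos (by linarith) (mul_pos (hlam.1 α₀ hα₀) (Real.exp_pos _)))
    (SONCCone.add_mem hrest hmem) ?_
  rw [← add_assoc, Finset.add_sum_erase S
    (fun α => monomial α ((1 - r) * (lam α * Real.exp (b α)))) hα₀, circuitPoly, circuitPoly,
    ← add_assoc, ← Finset.sum_add_distrib]
  congr 1
  refine Finset.sum_congr rfl fun α _ => ?_
  rw [← map_add, Real.exp_add, Real.exp_log hr0]
  congr 1
  ring

end Cone

section Reduced

variable {n : ℕ} {A S : Finset (Fin n →₀ ℕ)} {β γ : Fin n →₀ ℕ} {lam b κ : (Fin n →₀ ℕ) → ℝ}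

lemma sum_filter_pos {M : Type*} [AddCommMonoid M] (h0 : ∀ α ∈ S, 0 ≤ κ α)
    {F : (Fin n →₀ ℕ) → M} (hF : ∀ α ∈ S, κ α = 0 → F α = 0) :
    ∑ α ∈ S with 0 < κ α, F α = ∑ α ∈ S, F α :=
  Finset.sum_filter_of_ne fun α hα hne =>
    lt_of_le_of_ne (h0 α hα) fun h => hne (hF α hα h.symm)

lemma isBarycentric_filter_pos (h0 : ∀ α ∈ S, 0 ≤ κ α) (h1 : ∑ α ∈ S, κ α = 1)
    (h2 : ∀ i, (γ i : ℝ) = ∑ α ∈ S, κ α * (α i : ℝ)) :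
    IsBarycentric {α ∈ S | 0 < κ α} γ κ := by
  refine ⟨fun α hα => (Finset.mem_filter.1 hα).2, ?_, fun i => ?_⟩
  · rw [sum_filter_pos h0 fun _ _ h => h, h1]
  · rw [sum_filter_pos h0 fun _ _ h => by rw [h, zero_mul], h2]

/-- Exchange property for affine independence. -/
lemma IsAffIndep.insert_erase [DecidableEq (Fin n →₀ ℕ)] (hS : IsAffIndep S) (hγ : γ ∉ S)
    (h1 : ∑ α ∈ S, κ α = 1)
    (h2 : ∀ i, (γ i : ℝ) = ∑ α ∈ S, κ α * (α i : ℝ)) {α₀ : Fin n →₀ ℕ} (hα₀ : α₀ ∈ S)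
    (hκ : κ α₀ ≠ 0) : IsAffIndep (insert γ (S.erase α₀)) := by
  intro w hw0 hw1
  have hγ' : γ ∉ S.erase α₀ := fun h => hγ (Finset.mem_of_mem_erase h)
  rw [Finset.sum_insert hγ'] at hw0
  have hsum : ∀ F : (Fin n →₀ ℕ) → ℝ, ∑ α ∈ S, (if α = α₀ then 0 else w α) * F α =
      ∑ α ∈ S.erase α₀, w α * F α := fun F => by
    rw [← Finset.add_sum_erase S _ hα₀]
    simp only [if_true, zero_mul, zero_add]
    exact Finset.sum_congr rfl fun α hα => by rw [if_neg (Finset.ne_of_mem_erase hα)]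
  have key := hS (fun α => w γ * κ α + if α = α₀ then 0 else w α)
    (by
      have := hsum (fun _ => 1)
      simp only [mul_one] at this
      rw [Finset.sum_add_distrib, this, ← Finset.mul_sum, h1, mul_one, hw0])
    (fun i => by
      have := hw1 i
      rw [Finset.sum_insert hγ', h2 i, Finset.mul_sum] at this
      simp only [add_mul, Finset.sum_add_distrib, mul_assoc]
      rw [hsum (fun α => (α i : ℝ)), this])
  have hwγ : w γ = 0 := by
    have := key α₀ hα₀
    simpa [hκ] using this
  intro α hα
  rcases Finset.mem_insert.1 hα with rfl | hα
  · exact hwγ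
  · have := key α (Finset.mem_of_mem_erase hα)
    simpa [hwγ, Finset.ne_of_mem_erase hα] using this

/-- The circuit of an extreme circuit polynomial is reduced. -/
lemma IsExtremeRay.reduced (hc : IsCircuitOn A S β) (hβ : β ∉ S) (hlam : IsBarycentric S β lam)
    {s : ℝ} (hs : s = 1 ∨ s = -1)
    (hf : IsExtremeRay (SONCCone A) (circuitPoly S β (fun α => lam α * Real.exp (b α))
      (-(s * Real.exp (∑ α ∈ S, lam α * b α)))))
    (hγA : γ ∈ A) (hγe : IsEvenPt γ)
    (hγ : toR γ ∈ convexHull ℝ (toR '' (S : Set (Fin n →₀ ℕ)))) : γ ∈ S ∨ γ = β := by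
  classical
  by_contra! hcon
  obtain ⟨hγS, hγβ⟩ := hcon
  obtain ⟨κ, hκ0, hκ1, hκ2⟩ := mem_convexHull_toR_iff.1 hγ
  have hκb := isBarycentric_filter_pos hκ0 hκ1 hκ2
  set S₁ := {α ∈ S | 0 < κ α} with hS₁
  have hS₁S : S₁ ⊆ S := Finset.filter_subset _ _
  have hc₁ : IsCircuitOn A S₁ γ := isCircuitOn_iff.2 ⟨hS₁S.trans hc.subset,
    fun α hα => hc.even_mem α (hS₁S hα), hγA, hc.isAffIndep.mono hS₁S, κ, hκb⟩
  have hγS₁ : γ ∉ S₁ := fun h => hγS (hS₁S h)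
  have hβS₁ : β ∉ S₁ := fun h => hβ (hS₁S h)
  obtain ⟨α₀, hα₀, hmin⟩ := S₁.exists_min_image (fun α => lam α / κ α)
    ((hκb.exists_ne hγS₁ γ).imp fun _ h => h.1)
  have hκα₀ : 0 < κ α₀ := hκb.1 α₀ hα₀
  have hα₀S := hS₁S hα₀
  set μ := lam α₀ / κ α₀ with hμ
  have hμ0 : 0 < μ := div_pos (hlam.1 α₀ hα₀S) hκα₀
  have hνS : ∀ α ∈ S, 0 ≤ lam α - μ * κ α := fun α hα => by
    rcases (hκ0 α hα).eq_or_lt with h | h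
    · rw [← h, mul_zero, sub_zero]
      exact (hlam.1 α hα).le
    · have := (le_div_iff₀ h).1 (hmin α (Finset.mem_filter.2 ⟨hα, h⟩))
      linarith
  set ν : (Fin n →₀ ℕ) → ℝ := fun α => if α = γ then μ else lam α - μ * κ α with hν
  have hνγ : ν γ = μ := if_pos rfl
  have hneγ : ∀ α ∈ S, α ≠ γ := fun α hα h => hγS (h ▸ hα)
  have hνne : ∀ α ∈ S, ν α = lam α - μ * κ α := fun α hα => if_neg (hneγ α hα)
  have hν0 : ∀ α ∈ insert γ S, 0 ≤ ν α := fun α hα => by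
    rcases Finset.mem_insert.1 hα with rfl | hα
    · rw [hνγ]
      exact hμ0.le
    · rw [hνne α hα]
      exact hνS α hα
  have hνsum : ∀ F : (Fin n →₀ ℕ) → ℝ, ∑ α ∈ insert γ S, ν α * F α =
      μ * F γ + (∑ α ∈ S, lam α * F α - μ * ∑ α ∈ S, κ α * F α) := fun F => by
    rw [Finset.sum_insert hγS, hνγ, Finset.mul_sum, ← Finset.sum_sub_distrib]
    congr 1
    exact Finset.sum_congr rfl fun α hα => by rw [hνne α hα]; ring
  have hνb := isBarycentric_filter_pos (γ := β) hν0
    (by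
      have := hνsum (fun _ => 1)
      simp only [mul_one, hlam.2.1, hκ1] at this
      rw [this]
      ring)
    (fun i => by
      rw [hνsum (fun α => (α i : ℝ)), ← hlam.2.2, ← show toR γ i = _ from hκ2 i]
      simp [toR])
  set T := {α ∈ insert γ S | 0 < ν α} with hT
  have hTS : T ⊆ insert γ (S.erase α₀) := fun α hα => by
    obtain ⟨hαI, hpos⟩ := Finset.mem_filter.1 hα
    rcases Finset.mem_insert.1 hαI with rfl | hαS
    · exact Finset.mem_insert_self _ _
    · refine Finset.mem_insert_of_mem (Finset.mem_erase.2 ⟨?_, hαS⟩)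
      rintro rfl
      rw [hνne _ hαS, hμ, div_mul_cancel₀ _ hκα₀.ne', sub_self] at hpos
      exact lt_irrefl _ hpos
  have hTI : T ⊆ insert γ S := Finset.filter_subset _ _
  have hcT : IsCircuitOn A T β := isCircuitOn_iff.2
    ⟨hTI.trans (Finset.insert_subset hγA hc.subset), fun α hα => by
      rcases Finset.mem_insert.1 (hTI hα) with rfl | hα
      · exact hγe
      · exact hc.even_mem α hα,
    hc.beta_mem, (hc.isAffIndep.insert_erase hγS hκ1 hκ2 hα₀S hκα₀.ne').mono hTS, ν, hνb⟩
  set b' : (Fin n →₀ ℕ) → ℝ := fun α => if α = γ then ∑ α ∈ S, κ α * b α else b α with hb'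
  have hb'γ : b' γ = ∑ α ∈ S, κ α * b α := if_pos rfl
  have hb'ne : ∀ α ∈ S, b' α = b α := fun α hα => if_neg (hneγ α hα)
  have hκS₁ : ∑ α ∈ S₁, κ α * b α = ∑ α ∈ S, κ α * b α :=
    sum_filter_pos hκ0 fun _ _ h => by rw [h, zero_mul]
  have hΘ : ∑ α ∈ T, ν α * b' α = ∑ α ∈ S, lam α * b α := by
    have h (w : (Fin n →₀ ℕ) → ℝ) : ∑ α ∈ S, w α * b' α = ∑ α ∈ S, w α * b α :=
      Finset.sum_congr rfl fun α hα => by rw [hb'ne α hα]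
    rw [sum_filter_pos hν0 fun _ _ h => by rw [h, zero_mul], hνsum, hb'γ, h, h]
    ring
  have hΘpos := Real.exp_pos (∑ α ∈ S, lam α * b α)
  have hmem₁ := hc₁.circuitPoly_mem_cone (b := b) hκb
    (d := -Real.exp (∑ α ∈ S₁, κ α * b α)) le_rfl (fun h => absurd hγe h)
  have hmemT := hcT.circuitPoly_mem_cone (b := b') hνb
    (d := -(s * Real.exp (∑ α ∈ S, lam α * b α)))
    (by rw [hΘ]; rcases hs with rfl | rfl <;> linarith)
    (by rw [hΘ]; rcases hs with rfl | rfl <;> intro <;> linarith)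
  have hdecomp : circuitPoly S β (fun α => lam α * Real.exp (b α))
        (-(s * Real.exp (∑ α ∈ S, lam α * b α))) =
      circuitPoly T β (fun α => ν α * Real.exp (b' α))
        (-(s * Real.exp (∑ α ∈ S, lam α * b α))) +
      μ • circuitPoly S₁ γ (fun α => κ α * Real.exp (b α))
        (-Real.exp (∑ α ∈ S₁, κ α * b α)) := by
    simp only [circuitPoly]
    rw [sum_filter_pos hν0 fun _ _ h => by simp [h], sum_filter_pos hκ0 fun _ _ h => by simp [h],
      Finset.sum_insert hγS, hνγ, hb'γ, hκS₁, smul_add, Finset.smul_sum, smul_monomial]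
    have e1 : ∑ α ∈ S, (monomial α (ν α * Real.exp (b' α)) : MvPolynomial (Fin n) ℝ) =
        ∑ α ∈ S, monomial α (lam α * Real.exp (b α)) -
          ∑ α ∈ S, μ • monomial α (κ α * Real.exp (b α)) := by
      rw [← Finset.sum_sub_distrib]
      refine Finset.sum_congr rfl fun α hα => ?_
      rw [hνne α hα, hb'ne α hα, smul_monomial, ← map_sub, smul_eq_mul]
      congr 1
      ring
    simp only [e1, smul_eq_mul, mul_neg, map_neg]
    abel
  obtain ⟨t, -, ht⟩ := (hf.2.2 _ _ hmemT (SONCCone.smul_mem hμ0.le hmem₁) hdecomp).2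
  have hcoefβ := congrArg (coeffFunctional fun α => if α = β then 1 else 0) ht
  have hcoefγ := congrArg (coeffFunctional fun α => if α = γ then 1 else 0) ht
  simp only [map_smul, coeffFunctional_circuitPoly, smul_eq_mul, mul_ite, mul_one, mul_zero,
    Finset.sum_ite_eq', hβS₁, hβ, hγβ, hγS, hγS₁, if_false, if_true, zero_add, Ne.symm hγβ,
    add_zero] at hcoefβ hcoefγ
  have hne : μ * -Real.exp (∑ α ∈ S₁, κ α * b α) < 0 :=
    mul_neg_of_pos_of_neg hμ0 (neg_neg_of_pos (Real.exp_pos _))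
  exact hne.ne hcoefγ

end Reduced

section Weight

variable {n : ℕ} {A S : Finset (Fin n →₀ ℕ)} {β : Fin n →₀ ℕ} {lam : (Fin n →₀ ℕ) → ℝ}

lemma IsBarycentric.infDist_le (h : IsBarycentric S β lam) {K : Set (Fin n → ℝ)}
    (hK : IsCompact K) (hconv : Convex ℝ K) (hne : K.Nonempty) :
    Metric.infDist (toR β) K ≤ ∑ α ∈ S, lam α * Metric.infDist (toR α) K := by
  choose p hpK hp using fun x => hK.exists_infDist_eq_dist hne x
  have hβ : toR β = ∑ α ∈ S, lam α • toR α := by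
    ext i
    simpa [toR] using h.2.2 i
  have hmem : ∑ α ∈ S, lam α • p (toR α) ∈ K :=
    hconv.sum_mem (fun α hα => (h.1 α hα).le) h.2.1 fun α _ => hpK _
  refine (Metric.infDist_le_dist_of_mem hmem).trans ?_
  rw [hβ]
  refine (dist_sum_sum_le _ _ _).trans (Finset.sum_le_sum fun α hα => ?_)
  rw [dist_smul₀, Real.norm_of_nonneg (h.1 α hα).le, hp]

/-- A reduced circuit is selected by a weight that is affine on it and strictly convex on every
other circuit. -/
lemma IsCircuitOn.exists_weight (hc : IsCircuitOn A S β) (hβ : β ∉ S)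
    (hlam : IsBarycentric S β lam)
    (hred : ∀ γ ∈ A, IsEvenPt γ → toR γ ∈ convexHull ℝ (toR '' (S : Set (Fin n →₀ ℕ))) →
      γ ∈ S ∨ γ = β) (b : (Fin n →₀ ℕ) → ℝ) :
    ∃ w : (Fin n →₀ ℕ) → ℝ, (∀ α ∈ S, w α = -b α) ∧ w β = ∑ α ∈ S, lam α * w α ∧
      ∀ S' β' lam', IsCircuitOn A S' β' → β' ∉ S' → IsBarycentric S' β' lam' →
        (β' = β → S' ≠ S) → w β' < ∑ α ∈ S', lam' α * w α := by
  classical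
  set K := convexHull ℝ (toR '' (S : Set (Fin n →₀ ℕ))) with hKdef
  have hK : IsCompact K := (S.finite_toSet.image toR).isCompact_convexHull ℝ
  have hβK : toR β ∈ K := intrinsicInterior_subset hc.relint
  have hne : K.Nonempty := ⟨_, hβK⟩
  have hconv : Convex ℝ K := convex_convexHull ℝ _
  set φ : (Fin n →₀ ℕ) → ℝ := fun γ => Metric.infDist (toR γ) K with hφ
  have hφβ : φ β = 0 := Metric.infDist_zero_of_mem hβK
  have hφS : ∀ α ∈ S, φ α = 0 := fun α hα => Metric.infDist_zero_of_mem
    (subset_convexHull ℝ _ ⟨α, hα, rfl⟩)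
  have hφ0 : ∀ γ, 0 ≤ φ γ := fun γ => Metric.infDist_nonneg
  set q : (Fin n →₀ ℕ) → ℝ := fun γ => ∑ i, (γ i : ℝ) ^ 2 with hq
  set ψ : (Fin n →₀ ℕ) → ℝ := fun γ => if γ = β then ∑ α ∈ S, lam α * q α else q γ with hψ
  have hψβ : ψ β = ∑ α ∈ S, lam α * q α := if_pos rfl
  have hψne : ∀ γ, γ ≠ β → ψ γ = q γ := fun γ h => if_neg h
  have hqψ : ∀ γ, q γ ≤ ψ γ := fun γ => by
    rcases eq_or_ne γ β with rfl | h
    · rw [hψβ]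
      exact (hlam.sq_lt hβ).le
    · exact (hψne γ h).ge
  have hψS : ∀ α ∈ S, ψ α = q α := fun α hα => hψne α fun h => hβ (h ▸ hα)
  have hφpos : ∀ S' lam', IsCircuitOn A S' β → β ∉ S' → IsBarycentric S' β lam' → S' ≠ S →
      0 < ∑ α ∈ S', lam' α * φ α := fun S' lam' hc' hβ' hlam' hSne => by
    refine Finset.sum_pos' (fun α hα => mul_nonneg (hlam'.1 α hα).le (hφ0 α)) ?_
    by_contra! hcon
    refine hSne (hc.isAffIndep.eq_of_subset_of_isBarycentric hlam (fun α hα => ?_) hlam')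
    have h0 : φ α = 0 := le_antisymm
      (nonpos_of_mul_nonpos_right (hcon α hα) (hlam'.1 α hα)) (hφ0 α)
    refine (hred α (hc'.subset hα) (hc'.even_mem α hα)
      ((hK.isClosed.mem_iff_infDist_zero hne).2 h0)).resolve_right ?_
    rintro rfl
    exact hβ' hα
  obtain ⟨M, hM, hM0⟩ : ∃ M : ℝ, (∀ S' ∈ A.powerset, ∀ lam', IsCircuitOn A S' β → β ∉ S' →
      IsBarycentric S' β lam' → S' ≠ S →
        ψ β < M * ∑ α ∈ S', lam' α * φ α + ∑ α ∈ S', lam' α * ψ α) ∧ 0 ≤ M := by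
    refine Filter.Eventually.exists (f := Filter.atTop)
      (((Filter.eventually_all_finset _).2 fun S' _ => ?_).and (Filter.eventually_ge_atTop 0))
    by_cases hex : ∃ κ, IsCircuitOn A S' β ∧ β ∉ S' ∧ IsBarycentric S' β κ ∧ S' ≠ S
    · obtain ⟨κ, hc', hβ', hκ, hSne⟩ := hex
      have hpos := hφpos S' κ hc' hβ' hκ hSne
      filter_upwards [(Filter.tendsto_id.atTop_mul_const hpos).eventually_gt_atTop
        (ψ β - ∑ α ∈ S', κ α * ψ α)] with M hM lam' _ _ hlam' _
      have hsum : ∀ F : (Fin n →₀ ℕ) → ℝ, ∑ α ∈ S', lam' α * F α = ∑ α ∈ S', κ α * F α :=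
        fun F => Finset.sum_congr rfl fun α hα => by
          rw [hc'.isAffIndep.isBarycentric_unique hκ hlam' α hα]
      rw [hsum, hsum]
      exact sub_lt_iff_lt_add.1 hM
    · exact Filter.Eventually.of_forall fun M lam' h1 h2 h3 h4 =>
        absurd ⟨lam', h1, h2, h3, h4⟩ hex
  obtain ⟨k, u, hku⟩ := hc.isAffIndep.exists_interpolation (fun α => -b α - q α)
  have hexp : ∀ (S' : Finset (Fin n →₀ ℕ)) β' lam', IsBarycentric S' β' lam' →
      ∑ α ∈ S', lam' α * (k + ∑ i, u i * (α i : ℝ) + M * φ α + ψ α) =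
        k + ∑ i, u i * (β' i : ℝ) + (M * ∑ α ∈ S', lam' α * φ α + ∑ α ∈ S', lam' α * ψ α) :=
    fun S' β' lam' h => by
      rw [← sum_mul_affine_eq h.2.1 (y := fun i => (β' i : ℝ)) h.2.2 k u, Finset.mul_sum,
        ← Finset.sum_add_distrib, ← Finset.sum_add_distrib]
      exact Finset.sum_congr rfl fun α _ => by ring
  refine ⟨fun γ => k + ∑ i, u i * (γ i : ℝ) + M * φ γ + ψ γ, fun α hα => ?_, ?_, ?_⟩
  · simp only [hku α hα, hφS α hα, hψS α hα]
    ring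
  · have h1 : ∑ α ∈ S, lam α * φ α = 0 := Finset.sum_eq_zero fun α hα => by
      rw [hφS α hα, mul_zero]
    have h2 : ∑ α ∈ S, lam α * ψ α = ψ β := by
      rw [hψβ]
      exact Finset.sum_congr rfl fun α hα => by rw [hψS α hα]
    rw [hexp S β lam hlam, h1, h2]
    simp only [hφβ]
    ring
  · intro S' β' lam' hc' hβ' hlam' hneq
    rw [hexp S' β' lam' hlam']
    simp only [add_assoc (k + _)]
    refine add_lt_add_right ?_ _
    rcases eq_or_ne β' β with rfl | hββ
    · rw [hφβ, mul_zero, zero_add]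
      exact hM S' (Finset.mem_powerset.2 hc'.subset) lam' hc' hβ' hlam' (hneq rfl)
    · refine add_lt_add_of_le_of_lt
        (mul_le_mul_of_nonneg_left (hlam'.infDist_le hK hconv hne) hM0) ?_
      rw [hψne β' hββ]
      exact (hlam'.sq_lt hβ').trans_le (Finset.sum_le_sum fun α hα =>
        mul_le_mul_of_nonneg_left (hqψ α) (hlam'.1 α hα).le)

end Weight

section Exposed

variable {n : ℕ} {A S : Finset (Fin n →₀ ℕ)} {β : Fin n →₀ ℕ} {lam b : (Fin n →₀ ℕ) → ℝ}

lemma smul_circuitPoly (t : ℝ) (c : (Fin n →₀ ℕ) → ℝ) (d : ℝ) :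
    t • circuitPoly S β c d = circuitPoly S β (fun α => t * c α) (t * d) := by
  simp [circuitPoly, smul_add, Finset.smul_sum, smul_monomial]

lemma isExposedRay_monomial {α : Fin n →₀ ℕ}
    (h : ∀ S β, IsCircuitOn A S β → α ∈ S → IsEvenPt β → β = α) :
    IsExposedRay (SONCCone A) (monomial α (1 : ℝ)) := by
  classical
  set q : (Fin n →₀ ℕ) → ℝ := fun γ => ∑ i, (γ i : ℝ) ^ 2 with hq
  set a : (Fin n →₀ ℕ) → ℝ := fun γ =>
    if γ = α then 0 else if IsEvenPt γ then Real.exp (q γ) else 0 with ha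
  have haα : a α = 0 := if_pos rfl
  have haE : ∀ γ, γ ≠ α → IsEvenPt γ → a γ = Real.exp (q γ) := fun γ hγ he => by
    simp only [ha, if_neg hγ, if_pos he]
  have ha0 : ∀ γ, 0 ≤ a γ := fun γ => by
    simp only [ha]
    split_ifs <;> positivity
  refine isExposedRay_of_gen (coeffFunctional a)
    (by rw [coeffFunctional_monomial, haα, mul_zero]) fun g hg => ?_
  rcases SONCGen.cases hg with ⟨γ, -, hγe, t, ht, rfl⟩ | ⟨S', β', κ, b', d, hc, hβ, hκ, rfl, hd, -⟩
  · rw [coeffFunctional_monomial]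
    refine ⟨mul_nonneg ht (ha0 γ), fun h0 => ?_⟩
    rcases mul_eq_zero.1 h0 with rfl | h0
    · rw [map_zero]
      exact zero_mem_raySet _
    · obtain rfl : γ = α := by
        by_contra hne
        rw [haE γ hne hγe] at h0
        exact (Real.exp_pos _).ne' h0
      exact ⟨t, ht, by rw [smul_monomial, smul_eq_mul, mul_one]⟩
  · suffices hpos : 0 < coeffFunctional a (circuitPoly S' β' (fun α => κ α * Real.exp (b' α)) d) from
      ⟨hpos.le, fun h0 => absurd h0 hpos.ne'⟩
    rw [coeffFunctional_circuitPoly]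
    by_cases hβ' : IsEvenPt β' ∧ β' ≠ α
    · have hαS : α ∉ S' := fun hα => hβ'.2 (h S' β' hc hα hβ'.1)
      rw [haE β' hβ'.2 hβ'.1, Finset.sum_congr rfl fun γ hγ => by
        rw [haE γ (fun h => hαS (h ▸ hγ)) (hc.even_mem γ hγ)]]
      have h1 := exp_sum_mul_exp_lt (b := b') hκ (hκ.sq_lt hβ)
      have h2 := mul_le_mul_of_nonneg_right hd (Real.exp_pos (q β')).le
      linarith
    · have haβ : a β' = 0 := by
        by_cases h1 : β' = α
        · rw [h1, haα]
        · simp only [ha, if_neg h1, if_neg fun he => hβ' ⟨he, h1⟩]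
      rw [haβ, mul_zero, add_zero]
      obtain ⟨γ, hγ, hne⟩ := hκ.exists_ne hβ α
      refine Finset.sum_pos' (fun γ hγ => mul_nonneg
        (mul_pos (hκ.1 γ hγ) (Real.exp_pos _)).le (ha0 γ)) ⟨γ, hγ, ?_⟩
      rw [haE γ hne (hc.even_mem γ hγ)]
      have := hκ.1 γ hγ
      positivity

lemma IsCircuitOn.isExposedRay (hc : IsCircuitOn A S β) (hβ : β ∉ S)
    (hlam : IsBarycentric S β lam)
    (hred : ∀ γ ∈ A, IsEvenPt γ → toR γ ∈ convexHull ℝ (toR '' (S : Set (Fin n →₀ ℕ))) →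
      γ ∈ S ∨ γ = β) {s : ℝ} (hs : s = 1 ∨ s = -1) (hs' : IsEvenPt β → s = 1) :
    IsExposedRay (SONCCone A) (circuitPoly S β (fun α => lam α * Real.exp (b α))
      (-(s * Real.exp (∑ α ∈ S, lam α * b α)))) := by
  classical
  obtain ⟨w, hwS, hwβ, hw⟩ := hc.exists_weight hβ hlam hred b
  have hss : s * s = 1 := by rcases hs with rfl | rfl <;> norm_num
  set a : (Fin n →₀ ℕ) → ℝ := fun γ =>
    if γ = β then s * Real.exp (w β) else if IsEvenPt γ then Real.exp (w γ) else 0 with ha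
  have haβ : a β = s * Real.exp (w β) := if_pos rfl
  have haE : ∀ γ, IsEvenPt γ → a γ = Real.exp (w γ) := fun γ he => by
    rcases eq_or_ne γ β with rfl | hne
    · rw [haβ, hs' he, one_mul]
    · simp only [ha, if_neg hne, if_pos he]
  have haO : ∀ γ, γ ≠ β → ¬ IsEvenPt γ → a γ = 0 := fun γ hne he => by
    simp only [ha, if_neg hne, if_neg he]
  have hval : ∀ S' β' (κ b' : (Fin n →₀ ℕ) → ℝ) (d : ℝ), IsCircuitOn A S' β' →
      coeffFunctional a (circuitPoly S' β' (fun α => κ α * Real.exp (b' α)) d) =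
        ∑ α ∈ S', κ α * Real.exp (b' α) * Real.exp (w α) + d * a β' := fun S' β' κ b' d hc' => by
    rw [coeffFunctional_circuitPoly, Finset.sum_congr rfl fun α hα => by
      rw [haE α (hc'.even_mem α hα)]]
  refine isExposedRay_of_gen (coeffFunctional a) ?_ fun g hg => ?_
  · have h1 : ∑ α ∈ S, lam α * Real.exp (b α) * Real.exp (w α) = 1 := by
      rw [← hlam.2.1]
      refine Finset.sum_congr rfl fun α hα => ?_
      rw [hwS α hα, mul_assoc, ← Real.exp_add, add_neg_cancel, Real.exp_zero, mul_one]
    have h2 : Real.exp (∑ α ∈ S, lam α * b α) * Real.exp (w β) = 1 := by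
      rw [← Real.exp_add, hwβ, ← Finset.sum_add_distrib, Finset.sum_eq_zero, Real.exp_zero]
      intro α hα
      rw [hwS α hα]
      ring
    rw [hval _ _ _ _ _ hc, h1, haβ]
    linear_combination -(s * s) * h2 - hss
  rcases SONCGen.cases hg with
    ⟨γ, -, hγe, t, ht, rfl⟩ | ⟨S', β', κ, b', d, hc', hβ', hκ, rfl, hd, hd'⟩
  · rw [coeffFunctional_monomial, haE γ hγe]
    refine ⟨mul_nonneg ht (Real.exp_pos _).le, fun h0 => ?_⟩
    rw [(mul_eq_zero.1 h0).resolve_right (Real.exp_pos _).ne', map_zero]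
    exact zero_mem_raySet _
  rw [hval _ _ _ _ _ hc']
  set Θ := Real.exp (∑ α ∈ S', κ α * b' α) with hΘ
  have hsd : β' = β → -Θ ≤ s * d := fun h => by
    subst h
    rcases hs with rfl | rfl
    · linarith
    · have := hd' fun he => by linarith [hs' he]
      linarith
  have hdw : IsEvenPt β' ∨ β' = β → -Θ * Real.exp (w β') ≤ d * a β' := fun h => by
    by_cases hββ : β' = β
    · have := mul_le_mul_of_nonneg_right (hsd hββ) (Real.exp_pos (w β')).le
      subst hββ
      rw [haβ]
      linarith
    · rw [haE β' (h.resolve_right hββ)]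
      exact mul_le_mul_of_nonneg_right hd (Real.exp_pos _).le
  by_cases hsame : β' = β → S' ≠ S
  · suffices hpos : 0 < ∑ α ∈ S', κ α * Real.exp (b' α) * Real.exp (w α) + d * a β' from
      ⟨hpos.le, fun h0 => absurd h0 hpos.ne'⟩
    by_cases h : IsEvenPt β' ∨ β' = β
    · have := exp_sum_mul_exp_lt (b := b') hκ (hw S' β' κ hc' hβ' hκ hsame)
      linarith [hdw h]
    · push Not at h
      rw [haO β' h.2 h.1, mul_zero, add_zero]
      obtain ⟨γ, hγ, -⟩ := hκ.exists_ne hβ' β'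
      exact Finset.sum_pos (fun γ hγ => mul_pos (mul_pos (hκ.1 γ hγ) (Real.exp_pos _))
        (Real.exp_pos _)) ⟨γ, hγ⟩
  push Not at hsame
  obtain ⟨rfl, rfl⟩ := hsame
  have hκlam := hc.isAffIndep.isBarycentric_unique hlam hκ
  have hwβ' : w β' = ∑ α ∈ S', κ α * w α := by
    rw [hwβ]
    exact Finset.sum_congr rfl fun α hα => by rw [hκlam α hα]
  have hle := exp_sum_mul_exp_le (w := w) (b := b') hκ
  rw [← hwβ'] at hle
  refine ⟨by linarith [hdw (Or.inr rfl)], fun h0 => ?_⟩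
  obtain ⟨τ, hτ⟩ := eq_of_exp_sum_mul_exp_eq (w := w) (b := b') hκ
    (by rw [← hwβ']; linarith [hdw (Or.inr rfl)])
  have hb' : ∀ α ∈ S', b' α = b α + τ := fun α hα => by
    linarith [hτ α hα, hwS α hα]
  have hsdeq : s * d = -Θ := by
    refine le_antisymm ?_ (hsd rfl)
    rw [haβ] at h0
    refine le_of_mul_le_mul_right ?_ (Real.exp_pos (w β'))
    linarith
  have hΘτ : Θ = Real.exp τ * Real.exp (∑ α ∈ S', lam α * b α) := by
    rw [hΘ, ← Real.exp_add, add_comm τ]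
    congr 1
    calc ∑ α ∈ S', κ α * b' α = ∑ α ∈ S', (lam α * b α + lam α * τ) :=
          Finset.sum_congr rfl fun α hα => by rw [hκlam α hα, hb' α hα, mul_add]
      _ = ∑ α ∈ S', lam α * b α + τ := by
          rw [Finset.sum_add_distrib, ← Finset.sum_mul, hlam.2.1, one_mul]
  refine ⟨Real.exp τ, (Real.exp_pos _).le, ?_⟩
  rw [smul_circuitPoly, circuitPoly_congr fun α hα => by
    rw [hκlam α hα, hb' α hα, Real.exp_add, mul_comm (Real.exp (b α)), mul_left_comm]]
  congr 1
  linear_combination s * hsdeq - d * hss - s * hΘτ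

lemma IsCircuitOn.not_isExposedRay {α : Fin n →₀ ℕ} (hc : IsCircuitOn A S β) (hα : α ∈ S)
    (hβα : β ≠ α) (hβe : IsEvenPt β) :
    ¬ IsExposedRay (SONCCone A) (monomial α (1 : ℝ)) := by
  classical
  rintro ⟨l, hl0, hlpos⟩
  obtain ⟨lam, hlam⟩ := hc.exists_isBarycentric
  have hβS : β ∉ S := fun h => hβα (by
    have := hc.isAffIndep.eq_singleton_of_mem hlam h
    rw [this, Finset.mem_singleton] at hα
    exact hα.symm)
  have hlα : l (monomial α 1) = 0 := hl0 _ (mem_raySet_self _)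
  have hlβ : 0 < l (monomial β 1) := by
    refine hlpos _ ⟨SONCCone.monomial_mem hc.beta_mem hβe zero_le_one, ?_⟩
    rintro ⟨t, -, ht⟩
    have := congrArg (coeff β) ht
    simp [coeff_monomial, hβα.symm] at this
  have hl : ∀ g ∈ SONCCone A, 0 ≤ l g := fun g hg => by
    by_cases h : g ∈ raySet (monomial α (1 : ℝ))
    · exact (hl0 g h).ge
    · exact (hlpos g ⟨hg, h⟩).le
  have hbound : ∀ τ : ℝ, Real.exp (lam α * τ) * l (monomial β 1) ≤
      ∑ γ ∈ S, lam γ * l (monomial γ 1) := fun τ => by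
    have hsum : ∑ γ ∈ S, lam γ * (if γ = α then τ else 0) = lam α * τ := by
      simp [hα]
    have := hl _ (hc.circuitPoly_mem_cone (b := fun γ => if γ = α then τ else 0) hlam le_rfl
      fun h => absurd hβe h)
    rw [map_circuitPoly, hsum] at this
    have heq : ∑ γ ∈ S, lam γ * Real.exp (if γ = α then τ else 0) * l (monomial γ 1) =
        ∑ γ ∈ S, lam γ * l (monomial γ 1) := Finset.sum_congr rfl fun γ _ => by
      split_ifs with h
      · rw [h, hlα, mul_zero, mul_zero]
      · rw [Real.exp_zero, mul_one]
    linarith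
  obtain ⟨τ, hτ⟩ := ((Real.tendsto_exp_atTop.comp
    (Filter.tendsto_id.const_mul_atTop (hlam.1 α hα))).atTop_mul_const hlβ).eventually_gt_atTop
      (∑ γ ∈ S, lam γ * l (monomial γ 1)) |>.exists
  exact (hbound τ).not_gt hτ

end Exposed

lemma isExposedRay_congr {n : ℕ} {K : Set (MvPolynomial (Fin n) ℝ)}
    {f g : MvPolynomial (Fin n) ℝ} (h : raySet f = raySet g) :
    IsExposedRay K f ↔ IsExposedRay K g := by
  rw [IsExposedRay, IsExposedRay, h]

/-- **Main theorem.** An extreme ray `r` of the SONC cone on a finite ground set `A` is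
not exposed if and only if `r = ℝ₊ · x^α` for some `α ∈ A` and there exists a circuit
`(S, β)` on `A` with `α ∈ S` and `β ≠ α` even. -/
theorem sonc_extreme_ray_not_exposed_iff {n : ℕ} (A : Finset (Fin n →₀ ℕ))
    (f : MvPolynomial (Fin n) ℝ) (hf : IsExtremeRay (SONCCone A) f) :
    ¬ IsExposedRay (SONCCone A) f ↔
      ∃ α ∈ A, raySet f = raySet ((monomial α (1 : ℝ) : MvPolynomial (Fin n) ℝ)) ∧
        ∃ S β, IsCircuitOn A S β ∧ α ∈ S ∧ β ≠ α ∧ IsEvenPt β := by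
  constructor
  · intro hne
    have hmon : ∀ α ∈ A, raySet f = raySet (monomial α (1 : ℝ)) →
        ∃ α ∈ A, raySet f = raySet ((monomial α (1 : ℝ) : MvPolynomial (Fin n) ℝ)) ∧
          ∃ S β, IsCircuitOn A S β ∧ α ∈ S ∧ β ≠ α ∧ IsEvenPt β := fun α hα h => by
      refine ⟨α, hα, h, ?_⟩
      by_contra! hcon
      refine hne ((isExposedRay_congr h).2 (isExposedRay_monomial fun S β hc hαS hβe => ?_))
      by_contra hβα
      exact hcon S β hc hαS hβα hβe
    obtain ⟨g, hg, hray, hext⟩ := hf.exists_gen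
    rcases SONCGen.cases hg with
      ⟨α, hα, -, t, ht, rfl⟩ | ⟨S, β, lam, b, d, hc, hβ, hlam, rfl, hd, hd'⟩
    · have ht' : 0 < t := lt_of_le_of_ne ht fun h0 => hext.1 (by rw [← h0, map_zero])
      exact hmon α hα (hray.trans (raySet_monomial α ht'))
    · rcases hext.eq_circuitNumber hc hβ hlam hd hd' with ⟨α, hα, h⟩ | h
      · exact hmon α (hc.subset hα) (hray.trans h)
      · obtain ⟨s, hs, hs', rfl⟩ : ∃ s : ℝ, (s = 1 ∨ s = -1) ∧ (IsEvenPt β → s = 1) ∧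
            d = -(s * Real.exp (∑ α ∈ S, lam α * b α)) := by
          rcases h with rfl | ⟨ho, rfl⟩
          · exact ⟨1, Or.inl rfl, fun _ => rfl, by ring⟩
          · exact ⟨-1, Or.inr rfl, fun he => absurd he ho, by ring⟩
        exact absurd ((isExposedRay_congr hray).2 (hc.isExposedRay hβ hlam
          (fun γ hγA hγe hγ => hext.reduced hc hβ hlam hs hγA hγe hγ) hs hs')) hne
  · rintro ⟨α, -, hray, S, β, hc, hα, hβα, hβe⟩
    rw [isExposedRay_congr hray]
    exact hc.not_isExposedRay hα hβα hβe
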